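/- For every a ∈ O there exists b ∈ O such that η(conj a) * a + η(conj b) + b = 0. (This is the paper's Lemma for polarities of type II: every non-absolute line through the point (∞) of the octonion plane contains an absolute point; it holds in every characteristic.) -/

import Mathlib

noncomputable section

open Quaternion

/-- Multiplication of the Cayley–Dickson double `O = D × D` of the quaternion algebra `D`. -/
def omul {E : Type*} [Field E] {c₁ c₂ : E} (β : E)
    (x y : ℍ[E,c₁,c₂] × ℍ[E,c₁,c₂]) : ℍ[E,c₁,c₂] × ℍ[E,c₁,c₂] :=
  (x.1 * y.1 - β • (y.2 * star x.2), y.1 * x.2 + star x.1 * y.2)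

/-- Conjugation of the Cayley–Dickson double. -/
def oconj {E : Type*} [Field E] {c₁ c₂ : E}
    (x : ℍ[E,c₁,c₂] × ℍ[E,c₁,c₂]) : ℍ[E,c₁,c₂] × ℍ[E,c₁,c₂] :=
  (star x.1, -x.2)

/-- Coordinatewise application of `γ` to a quaternion. -/
def qgal {E : Type*} [Field E] {c₁ c₂ : E} (γ : E →+* E)
    (x : ℍ[E,c₁,c₂]) : ℍ[E,c₁,c₂] :=
  ⟨γ x.re, γ x.imI, γ x.imJ, γ x.imK⟩

/-- The automorphism of `O` corresponding to a polarity of type II. -/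
def ηII {E : Type*} [Field E] {c₁ c₂ : E} (γ : E →+* E)
    (x : ℍ[E,c₁,c₂] × ℍ[E,c₁,c₂]) : ℍ[E,c₁,c₂] × ℍ[E,c₁,c₂] :=
  (qgal γ x.1, qgal γ x.2)

set_option maxHeartbeats 4000000 in
theorem hermX {E : Type*} [Field E] (γ : E →+* E)
    (hγ2 : ∀ x, γ (γ x) = x)
    (c₁ c₂ β : E) (hc₁ : γ c₁ = c₁) (hc₂ : γ c₂ = c₂) (hγβ : γ β = β)
    (a : ℍ[E,c₁,c₂] × ℍ[E,c₁,c₂]) :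
    ηII γ (oconj (omul β (ηII γ (oconj a)) a)) = omul β (ηII γ (oconj a)) a := by
  ext <;> simp [ηII, oconj, omul, qgal, hγ2, hc₁, hc₂, hγβ] <;> ring

theorem smulX {E : Type*} [Field E] (γ : E →+* E) {c₁ c₂ : E} (t : E)
    (a : ℍ[E,c₁,c₂] × ℍ[E,c₁,c₂]) :
    ηII γ (oconj (t • a)) = γ t • ηII γ (oconj a) := by
  ext <;> simp [ηII, oconj, qgal]

/-- for every `a ∈ O` there is `b ∈ O` with
`η(conj a)·a + η(conj b) + b = 0` (every non-absolute line through `(∞)` contains an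
absolute point; valid in every characteristic). -/
theorem exists_absolute_point {E : Type*} [Field E] (γ : E →+* E)
    (hγ2 : ∀ x, γ (γ x) = x) (hγne : γ ≠ RingHom.id E)
    (c₁ c₂ β : E) (hc₁ : γ c₁ = c₁) (hc₂ : γ c₂ = c₂) (hγβ : γ β = β) (hβ : β ≠ 0) :
    ∀ a : ℍ[E,c₁,c₂] × ℍ[E,c₁,c₂], ∃ b : ℍ[E,c₁,c₂] × ℍ[E,c₁,c₂],
      omul β (ηII γ (oconj a)) a + ηII γ (oconj b) + b = 0 := by
  intro a
  obtain ⟨x, hx⟩ : ∃ x, γ x ≠ x := by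
    by_contra! h
    exact hγne (RingHom.ext h)
  have h1 : x - γ x ≠ 0 := sub_ne_zero.mpr hx.symm
  obtain ⟨t, ht⟩ : ∃ t, γ t + t = 1 := by
    refine ⟨x / (x - γ x), ?_⟩
    have h2 : γ x - x ≠ 0 := sub_ne_zero.mpr hx
    rw [map_div₀, map_sub, hγ2, ← neg_sub x (γ x)]
    field_simp
    ring
  refine ⟨(-t) • omul β (ηII γ (oconj a)) a, ?_⟩
  rw [smulX, hermX γ hγ2 c₁ c₂ β hc₁ hc₂ hγβ, add_assoc, ← add_smul, map_neg, ← neg_add, ht]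
  simp
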